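/- Let n ≥ 3 and let A_1, …, A_n be positive semidefinite real symmetric matrices with A_1 + ⋯ + A_n ⪯ n·I. Then the average over all triples of distinct indices (i,j,k) of A_i A_j A_k satisfies −I ⪯ 𝔼̃_{i,j,k} A_i A_j A_k ⪯ I; equivalently, −n(n−1)(n−2)·I ⪯ Σ_{i,j,k distinct} A_i A_j A_k ⪯ n(n−1)(n−2)·I. -/

import Mathlib

open Matrix in
theorem aux_conj {d : ℕ} {P X : Matrix (Fin d) (Fin d) ℝ} (hP : P.PosSemidef)
    (hX : X.IsHermitian) : (X * P * X).PosSemidef := by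
  have h := hP.conjTranspose_mul_mul_same X
  rwa [hX.eq] at h

theorem aux_triple {n : ℕ} {M : Type*} [AddCommGroup M] (f : Fin n → Fin n → Fin n → M) :
    (∑ t ∈ Finset.univ.filter
        (fun t : Fin n × Fin n × Fin n =>
          t.1 ≠ t.2.1 ∧ t.1 ≠ t.2.2 ∧ t.2.1 ≠ t.2.2), f t.1 t.2.1 t.2.2) =
    ((∑ i, ∑ j, ∑ k, f i j k) - (∑ i, ∑ k, f i i k) - (∑ i, ∑ j, f i j i)
      - (∑ i, ∑ j, f i j j)) + ((∑ i, f i i i) + (∑ i, f i i i)) := by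
  have key : ∀ i j k : Fin n,
      (if (i ≠ j ∧ i ≠ k ∧ j ≠ k) then f i j k else 0) =
      f i j k - (if i = j then f i j k else 0) - (if i = k then f i j k else 0)
        - (if j = k then f i j k else 0)
        + ((if i = j then (if i = k then f i j k else 0) else 0)
          + (if i = j then (if i = k then f i j k else 0) else 0)) := by
    intro i j k
    by_cases h1 : i = j
    · subst h1
      by_cases h2 : i = k <;> simp [h2]
    · by_cases h2 : i = k
      · subst h2
        simp [h1, Ne.symm h1, eq_comm]
      · by_cases h3 : j = k <;> simp [h1, h2, h3]
  have e1 : ∀ i j : Fin n, (∑ k, if i = j then f i j k else 0) =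
      if i = j then ∑ k, f i j k else 0 := by
    intro i j; split_ifs <;> simp
  have e2 : ∀ i j : Fin n, (∑ k, if i = j then (if i = k then f i j k else 0) else 0) =
      if i = j then f i j i else 0 := by
    intro i j; split_ifs <;> simp
  rw [Finset.sum_filter, Fintype.sum_prod_type]
  simp only [Fintype.sum_prod_type, key, Finset.sum_add_distrib, Finset.sum_sub_distrib, e1, e2]
  simp

section
variable {d n : ℕ} (A : Fin n → Matrix (Fin d) (Fin d) ℝ)

theorem aux_F :
    (∑ t ∈ Finset.univ.filter
        (fun t : Fin n × Fin n × Fin n =>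
          t.1 ≠ t.2.1 ∧ t.1 ≠ t.2.2 ∧ t.2.1 ≠ t.2.2),
        A t.1 * A t.2.1 * A t.2.2) =
    ((∑ i, A i) * (∑ i, A i) * (∑ i, A i) - (∑ i, A i * A i) * (∑ i, A i)
      - (∑ i, A i * (∑ j, A j) * A i) - (∑ i, A i) * (∑ i, A i * A i))
      + ((∑ i, A i * A i * A i) + (∑ i, A i * A i * A i)) := by
  rw [aux_triple (fun i j k => A i * A j * A k)]
  have e : ∀ i j, A i * A j * A j = A i * (A j * A j) := fun i j => mul_assoc _ _ _
  have h1 : (∑ i, ∑ j, A i * A j * A j) = (∑ i, A i) * (∑ i, A i * A i) := by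
    simp only [e, ← Finset.mul_sum, ← Finset.sum_mul]
  have h2 : (∑ i, ∑ j, A i * A j * A i) = ∑ i, A i * (∑ j, A j) * A i := by
    simp only [← Finset.mul_sum, ← Finset.sum_mul]
  have h3 : (∑ i, ∑ j, A i * A i * A j) = (∑ i, A i * A i) * (∑ i, A i) := by
    simp only [← Finset.mul_sum, ← Finset.sum_mul]
  have h4 : (∑ i, ∑ j, ∑ k, A i * A j * A k) = (∑ i, A i) * (∑ i, A i) * (∑ i, A i) := by
    simp only [← Finset.mul_sum, ← Finset.sum_mul]
  simp only [h1, h2, h3, h4]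

theorem aux_G :
    (∑ t ∈ Finset.univ.filter
        (fun t : Fin n × Fin n × Fin n =>
          t.1 ≠ t.2.1 ∧ t.1 ≠ t.2.2 ∧ t.2.1 ≠ t.2.2),
        (A t.1 - A t.2.2) * A t.2.1 * (A t.1 - A t.2.2)) =
    (2 * (n : ℝ) - 2) • (∑ i, A i * (∑ j, A j) * A i)
      - (2 : ℝ) • ((∑ i, A i) * (∑ i, A i) * (∑ i, A i))
      - (2 * (n : ℝ)) • (∑ i, A i * A i * A i)
      + (2 : ℝ) • ((∑ i, A i * A i) * (∑ i, A i))
      + (2 : ℝ) • ((∑ i, A i) * (∑ i, A i * A i)) := by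
  rw [aux_triple (fun i j k => (A i - A k) * A j * (A i - A k))]
  have e : ∀ i j k, (A i - A k) * A j * (A i - A k) =
      A i * A j * A i - A i * A j * A k - A k * A j * A i + A k * A j * A k := by
    intro i j k
    noncomm_ring
  have h1 : (∑ i, ∑ j, A i * A j * A j) = (∑ i, A i) * (∑ i, A i * A i) := by
    simp only [mul_assoc]
    simp only [← Finset.mul_sum, ← Finset.sum_mul]
  have h1' : (∑ i, ∑ j, A j * A i * A i) = (∑ i, A i) * (∑ i, A i * A i) := by
    rw [Finset.sum_comm, h1]
  have h2 : (∑ i, ∑ j, A i * A j * A i) = ∑ i, A i * (∑ j, A j) * A i := by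
    simp only [← Finset.mul_sum, ← Finset.sum_mul]
  have h2' : (∑ i, ∑ j, A j * A i * A j) = ∑ i, A i * (∑ j, A j) * A i := by
    rw [Finset.sum_comm, h2]
  have h3 : (∑ i, ∑ j, A i * A i * A j) = (∑ i, A i * A i) * (∑ i, A i) := by
    simp only [← Finset.mul_sum, ← Finset.sum_mul]
  have h3' : (∑ i, ∑ j, A j * A j * A i) = (∑ i, A i * A i) * (∑ i, A i) := by
    rw [Finset.sum_comm, h3]
  have h4 : (∑ i, ∑ j, ∑ k, A i * A j * A k) = (∑ i, A i) * (∑ i, A i) * (∑ i, A i) := by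
    simp only [← Finset.mul_sum, ← Finset.sum_mul]
  have h4' : (∑ i, ∑ j, ∑ k, A k * A j * A i) = (∑ i, A i) * (∑ i, A i) * (∑ i, A i) := by
    simp only [← Finset.mul_sum, ← Finset.sum_mul]
  simp only [e, Finset.sum_add_distrib, Finset.sum_sub_distrib, h1, h1', h2, h2', h3, h3', h4,
    h4', Finset.sum_const, Finset.card_univ, Fintype.card_fin, ← Finset.smul_sum]
  simp only [← Nat.cast_smul_eq_nsmul ℝ]
  module

theorem aux_1 (hA : ∀ i, (A i).PosSemidef) (a b : ℝ) :
    ((∑ i, A i * A i * A i) + (2 * a) • (∑ i, A i * A i)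
      + b • ((∑ i, A i * A i) * (∑ i, A i)) + b • ((∑ i, A i) * (∑ i, A i * A i))
      + (a * a) • (∑ i, A i) + (2 * a * b) • ((∑ i, A i) * (∑ i, A i))
      + (b * b) • ((∑ i, A i) * (∑ i, A i) * (∑ i, A i))).PosSemidef := by
  have hS : (∑ i, A i).PosSemidef := Matrix.posSemidef_sum _ fun i _ => hA i
  set S := ∑ i, A i with hSd
  have h : (∑ i, (A i + a • (1 : Matrix (Fin d) (Fin d) ℝ) + b • S) * A i *
      (A i + a • (1 : Matrix (Fin d) (Fin d) ℝ) + b • S)).PosSemidef := by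
    refine Matrix.posSemidef_sum _ fun i _ => aux_conj (hA i) ?_
    refine ((hA i).isHermitian.add ?_).add ?_
    · simp [Matrix.IsHermitian, Matrix.conjTranspose_smul]
    · rw [Matrix.IsHermitian, Matrix.conjTranspose_smul, hS.isHermitian.eq, star_trivial]
  convert h using 1
  have e : ∀ i, (A i + a • (1 : Matrix (Fin d) (Fin d) ℝ) + b • S) * A i *
      (A i + a • (1 : Matrix (Fin d) (Fin d) ℝ) + b • S) =
      A i * A i * A i + (2 * a) • (A i * A i) + b • ((A i * A i) * S) + b • (S * (A i * A i))
      + (a * a) • A i + (a * b) • (S * A i) + (a * b) • (A i * S) + (b * b) • (S * A i * S) := by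
    intro i
    simp only [add_mul, mul_add, smul_mul_assoc, mul_smul_comm, one_mul, mul_one, mul_assoc,
      smul_add, smul_smul]
    module
  simp only [e, Finset.sum_add_distrib, ← Finset.smul_sum, ← Finset.sum_mul, ← Finset.mul_sum,
    ← hSd]
  module

theorem aux_2 (hA : ∀ i, (A i).PosSemidef)
    (hsum : ((n : ℝ) • (1 : Matrix (Fin d) (Fin d) ℝ) - ∑ i, A i).PosSemidef) (b : ℝ) :
    ((n : ℝ) • (∑ i, A i * A i) - (∑ i, A i * (∑ j, A j) * A i)
      + (2 * b + n * b * b) • ((n : ℝ) • ((∑ i, A i) * (∑ i, A i))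
        - (∑ i, A i) * (∑ i, A i) * (∑ i, A i))).PosSemidef := by
  have hS : (∑ i, A i).PosSemidef := Matrix.posSemidef_sum _ fun i _ => hA i
  set S := ∑ i, A i with hSd
  have h : (∑ i, (A i + b • S) * ((n : ℝ) • (1 : Matrix (Fin d) (Fin d) ℝ) - S) *
      (A i + b • S)).PosSemidef := by
    refine Matrix.posSemidef_sum _ fun i _ => aux_conj hsum ?_
    refine (hA i).isHermitian.add ?_
    rw [Matrix.IsHermitian, Matrix.conjTranspose_smul, hS.isHermitian.eq, star_trivial]
  convert h using 1
  have e : ∀ i, (A i + b • S) * ((n : ℝ) • (1 : Matrix (Fin d) (Fin d) ℝ) - S) *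
      (A i + b • S) =
      (n : ℝ) • (A i * A i) - A i * S * A i + (b * n) • (A i * S) + (b * n) • (S * A i)
      - b • (A i * (S * S)) - b • (S * S * A i)
      + (b * b) • ((n : ℝ) • (S * S) - S * S * S) := by
    intro i
    simp only [add_mul, mul_add, smul_mul_assoc, mul_smul_comm, one_mul, mul_one, mul_assoc,
      smul_add, smul_smul, sub_mul, mul_sub, smul_sub]
    module
  simp only [e, Finset.sum_add_distrib, Finset.sum_sub_distrib, ← Finset.smul_sum,
    ← Finset.sum_mul, ← Finset.mul_sum, ← hSd]
  simp only [Finset.sum_const, Finset.card_univ, Fintype.card_fin, mul_assoc, mul_smul_comm, smul_mul_assoc,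
    ← Nat.cast_smul_eq_nsmul ℝ]
  module

end


theorem stmt13 {d n : ℕ} (hn : 3 ≤ n) (A : Fin n → Matrix (Fin d) (Fin d) ℝ)
    (hA : ∀ i, (A i).PosSemidef)
    (hsum : ((n : ℝ) • (1 : Matrix (Fin d) (Fin d) ℝ) - ∑ i, A i).PosSemidef) :
    ((∑ t ∈ Finset.univ.filter
        (fun t : Fin n × Fin n × Fin n =>
          t.1 ≠ t.2.1 ∧ t.1 ≠ t.2.2 ∧ t.2.1 ≠ t.2.2),
        A t.1 * A t.2.1 * A t.2.2) -
      (-((n : ℝ) * ((n : ℝ) - 1) * ((n : ℝ) - 2))) •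
        (1 : Matrix (Fin d) (Fin d) ℝ)).PosSemidef ∧
    (((n : ℝ) * ((n : ℝ) - 1) * ((n : ℝ) - 2)) • (1 : Matrix (Fin d) (Fin d) ℝ) -
      ∑ t ∈ Finset.univ.filter
        (fun t : Fin n × Fin n × Fin n =>
          t.1 ≠ t.2.1 ∧ t.1 ≠ t.2.2 ∧ t.2.1 ≠ t.2.2),
        A t.1 * A t.2.1 * A t.2.2).PosSemidef := by
  have hS : (∑ i, A i).PosSemidef := Matrix.posSemidef_sum _ fun i _ => hA i
  have hn' : (3 : ℝ) ≤ n := by exact_mod_cast hn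
  have hn0 : (n : ℝ) ≠ 0 := by linarith
  have hn1 : (n : ℝ) - 1 ≠ 0 := by linarith
  have hG : (∑ t ∈ Finset.univ.filter
        (fun t : Fin n × Fin n × Fin n =>
          t.1 ≠ t.2.1 ∧ t.1 ≠ t.2.2 ∧ t.2.1 ≠ t.2.2),
        (A t.1 - A t.2.2) * A t.2.1 * (A t.1 - A t.2.2)).PosSemidef :=
    Matrix.posSemidef_sum _ fun t _ =>
      aux_conj (hA _) ((hA _).isHermitian.sub (hA _).isHermitian)
  rw [aux_G] at hG
  have h1 := aux_1 A hA
  have h2 := aux_2 A hA hsum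
  have h3 := aux_conj hsum hS.isHermitian
  have h4 : ∀ a : ℝ, ((∑ i, A i) - a • (1 : Matrix (Fin d) (Fin d) ℝ)).IsHermitian := fun a =>
    hS.isHermitian.sub (by simp [Matrix.IsHermitian, Matrix.conjTranspose_smul])
  have h5 := aux_conj hS (h4 (3 * n / 4))
  have h6 := aux_conj Matrix.PosSemidef.one (h4 (3 * n / 4))
  rw [aux_F]
  generalize (∑ i, A i * (∑ j, A j) * A i) = R at *
  generalize (∑ i, A i * A i * A i) = C at *
  generalize (∑ i, A i * A i) = Q at *
  generalize (∑ i, A i) = S at *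
  constructor
  · have c1 : (0 : ℝ) ≤ n * (n - 1) * (n - 2) - 27 / 128 * n ^ 3 := by
      have : (0 : ℝ) ≤ n * ((n - 1) * (n - 2) - 27 / 128 * n ^ 2) :=
        mul_nonneg (by linarith) (by nlinarith)
      nlinarith
    have H := (((((h1 0 (-3 / 4)).smul (show (0 : ℝ) ≤ 4 / 3 by norm_num)).add (h2 0)).add
      ((h1 (-(3 * n / 4)) 0).smul (show (0 : ℝ) ≤ 2 / 3 by norm_num))).add
      (((h5.smul (show (0 : ℝ) ≤ 1 / 4 by norm_num)).add
      (h6.smul (show (0 : ℝ) ≤ 3 * n / 8 by positivity))).add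
      (hS.smul (show (0 : ℝ) ≤ 3 / 64 * (n : ℝ) ^ 2 by positivity)))).add
      ((Matrix.PosSemidef.one (n := Fin d) (R := ℝ)).smul c1)
    convert H using 1
    simp only [add_mul, mul_add, smul_mul_assoc, mul_smul_comm, one_mul, mul_one, mul_assoc,
      smul_add, smul_smul, sub_mul, mul_sub, smul_sub]
    module
  · have c1 : (0 : ℝ) ≤ (n - 1) * (n - 2) := mul_nonneg (by linarith) (by linarith)
    have c2 : (0 : ℝ) ≤ 2 * (n - 1) * (n - 2) / n ^ 2 :=
      div_nonneg (by linarith) (by positivity)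
    have c3 : (0 : ℝ) ≤ (n - 2) / (n - 1) := div_nonneg (by linarith) (by linarith)
    have c4 : (0 : ℝ) ≤ (2 + (n - 2) / (n - 1)) / (2 * n) := by positivity
    have c5 : (0 : ℝ) ≤ 2 * (n - 2) / n := div_nonneg (by linarith) (by positivity)
    have H := (((hsum.smul c1).add (h3.smul c2)).add
      ((h1 (-(n - 1)) ((n - 2) / n)).smul c3)).add ((hG.smul c4).add
      ((h2 (-1 / n)).smul c5))
    convert H using 1
    simp only [add_mul, mul_add, smul_mul_assoc, mul_smul_comm, one_mul, mul_one, mul_assoc,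
      smul_add, smul_smul, sub_mul, mul_sub, smul_sub]
    match_scalars <;> field_simp <;> ring
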